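/- arXiv:2506.13591 — 2 statements merged into one kernel-verified Lean document; each statement's English description precedes it below -/
import Mathlib

section
/- Let (x) be a minimal reduction of a regular ideal I of R. Then R:(R:I) ⊆ Ī, and moreover (x) is a minimal reduction of the ideal R:(R:I). If in addition C ⊆ I and I is not principal, then x(Ī:Ī) ⊆ R:(R:I) ⊆ Ī. -/
open scoped nonZeroDivisors

noncomputable section

/-- `x ∈ R` is integral over the ideal `I`: it satisfies an equation of integral
dependence over `I`, i.e. a monic polynomial whose coefficient in degree
`deg - i` lies in `I ^ i`. -/
def IsIntegralOverIdeal {R : Type*} [CommRing R] (I : Ideal R) (x : R) : Prop :=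
  ∃ p : Polynomial R, p.Monic ∧ (∀ i < p.natDegree, p.coeff i ∈ I ^ (p.natDegree - i)) ∧
    Polynomial.eval x p = 0

/-- The integral closure of the ideal `I`, viewed as an `R`-submodule of `Q(R)`. -/
def intCl (R : Type*) [CommRing R] (I : Ideal R) : Submodule R (FractionRing R) :=
  Submodule.span R (algebraMap R (FractionRing R) '' {r : R | IsIntegralOverIdeal I r})

/-- `J` is a reduction of `I`: `J ⊆ I` and `J I^n = I^(n+1)` for some `n`. -/
def IsIdealReduction {R : Type*} [CommRing R] (J I : Ideal R) : Prop :=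
  J ≤ I ∧ ∃ n : ℕ, J * I ^ n = I ^ (n + 1)

/-- `J` is a minimal reduction of `I`: no reduction of `I` is properly contained in `J`. -/
def IsMinimalReduction {R : Type*} [CommRing R] (J I : Ideal R) : Prop :=
  IsIdealReduction J I ∧ ∀ K : Ideal R, IsIdealReduction K I → K ≤ J → K = J

/-- The ideal `I` of `R`, viewed as an `R`-submodule of `Q(R)`. -/
def idl (R : Type*) [CommRing R] (I : Ideal R) : Submodule R (FractionRing R) :=
  Submodule.map (Algebra.linearMap R (FractionRing R)) I

/-- The integral closure `R̄` of `R` in `Q(R)`, as an `R`-submodule of `Q(R)`. -/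
def Rbar (R : Type*) [CommRing R] : Submodule R (FractionRing R) :=
  Subalgebra.toSubmodule (integralClosure R (FractionRing R))

/-- The condC `C = R : R̄`, as an `R`-submodule of `Q(R)`. -/
def condC (R : Type*) [CommRing R] : Submodule R (FractionRing R) :=
  1 / Rbar R

/-- The product `z • I` of a submodule `I` of `Q(R)` by an element `z ∈ Q(R)`. -/
def smulQ {R : Type*} [CommRing R] (z : FractionRing R)
    (I : Submodule R (FractionRing R)) : Submodule R (FractionRing R) :=
  Submodule.span R {z} * I

/-- `I` is a (regular) fractional ideal of `R`: it contains a regular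
(= invertible) element of `Q(R)`, and `yI ⊆ R` for some regular `y ∈ R`. -/
def IsFracIdeal {R : Type*} [CommRing R] (I : Submodule R (FractionRing R)) : Prop :=
  (∃ u : (FractionRing R)ˣ, (u : FractionRing R) ∈ I) ∧
    ∃ y ∈ R⁰, smulQ (algebraMap R (FractionRing R) y) I ≤ 1

/-- `z ∈ Q(R)` is a reduction of the fractional ideal `F`: `z = x/y` with `y`
regular in `R`, `yF ⊆ R`, and `(x)` a minimal reduction of the ideal `yF` of `R`. -/
def IsFracReduction {R : Type*} [CommRing R] (z : FractionRing R)
    (F : Submodule R (FractionRing R)) : Prop :=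
  ∃ x y : R, y ∈ R⁰ ∧
    z * algebraMap R (FractionRing R) y = algebraMap R (FractionRing R) x ∧
    smulQ (algebraMap R (FractionRing R) y) F ≤ 1 ∧
    IsMinimalReduction (Ideal.span {x})
      (Submodule.comap (Algebra.linearMap R (FractionRing R))
        (smulQ (algebraMap R (FractionRing R) y) F))

section

variable {R : Type*} [CommRing R]

lemma mem_idl_algebraMap {I : Ideal R} {r : R} :
    algebraMap R (FractionRing R) r ∈ idl R I ↔ r ∈ I := by
  refine ⟨?_, fun h => ⟨r, h, rfl⟩⟩
  rintro ⟨s, hs, h⟩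
  rwa [← IsFractionRing.injective R (FractionRing R) h]

lemma exists_inv_algebraMap {x : R} (hx : x ∈ R⁰) :
    ∃ y : FractionRing R, algebraMap R (FractionRing R) x * y = 1 :=
  (IsLocalization.map_units (FractionRing R) (⟨x, hx⟩ : R⁰)).exists_right_inv

/-- An element stabilising a finitely generated submodule that contains an invertible element
is integral. -/
lemma isIntegral_of_mul_mem_of_fg [IsNoetherianRing R] {A : Type*} [CommRing A] [Algebra R A]
    {N : Submodule R A} (hN : N.FG) {u v : A} (huN : u ∈ N) (huv : u * v = 1) {z : A}
    (hz : ∀ n ∈ N, z * n ∈ N) : IsIntegral R z := by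
  let S : Subalgebra R A :=
    { carrier := {w | ∀ n ∈ N, w * n ∈ N}
      mul_mem' := fun {a b} ha hb n hn => by
        rw [mul_assoc]
        exact ha _ (hb _ hn)
      add_mem' := fun {a b} ha hb n hn => by
        rw [add_mul]
        exact N.add_mem (ha _ hn) (hb _ hn)
      algebraMap_mem' := fun r n hn => by
        rw [← Algebra.smul_def]
        exact N.smul_mem r hn }
  have hle : Subalgebra.toSubmodule S ≤ N.map (LinearMap.mulRight R v) := fun w hw =>
    ⟨w * u, hw u huN, by simp [mul_assoc, huv]⟩
  have := isNoetherian_of_fg_of_noetherian _ (hN.map (LinearMap.mulRight R v))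
  have hfg : (Subalgebra.toSubmodule S).FG := by
    have := isNoetherian_of_le hle
    exact (Submodule.fg_top _).mp (IsNoetherian.noetherian _)
  exact IsIntegral.of_mem_of_fg S hfg z hz

lemma mem_nonZeroDivisors_of_isIdealReduction {I : Ideal R} {x : R}
    (hreg : ∃ r ∈ I, r ∈ R⁰) (hx : IsIdealReduction (Ideal.span {x}) I) : x ∈ R⁰ := by
  obtain ⟨r, hrI, hr⟩ := hreg
  obtain ⟨-, n, hn⟩ := hx
  have hmem : r ^ (n + 1) ∈ Ideal.span {x} * I ^ n := hn ▸ Ideal.pow_mem_pow hrI (n + 1)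
  obtain ⟨z, -, hz⟩ := Ideal.mem_span_singleton_mul.mp hmem
  have h : x * z ∈ R⁰ := hz ▸ pow_mem hr (n + 1)
  exact (mul_mem_nonZeroDivisors.mp h).1

lemma mul_mem_Rbar_of_isIdealReduction [IsNoetherianRing R] {I : Ideal R} {x : R} (hx0 : x ∈ R⁰)
    (hx : IsIdealReduction (Ideal.span {x}) I) {y : FractionRing R}
    (hy : algebraMap R (FractionRing R) x * y = 1) {i : R} (hi : i ∈ I) :
    algebraMap R (FractionRing R) i * y ∈ Rbar R := by
  obtain ⟨hle, n, hn⟩ := hx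
  have hxI : x ∈ I := hle (Ideal.mem_span_singleton_self x)
  obtain ⟨v, hv⟩ := exists_inv_algebraMap (pow_mem hx0 n)
  refine isIntegral_of_mul_mem_of_fg (N := idl R (I ^ n))
    (Submodule.FG.map _ (IsNoetherian.noetherian (I ^ n)))
    (mem_idl_algebraMap.mpr (Ideal.pow_mem_pow hxI n)) hv ?_
  rintro - ⟨a, ha, rfl⟩
  have hmem : i * a ∈ Ideal.span {x} * I ^ n := by
    rw [hn, pow_succ']
    exact Ideal.mul_mem_mul hi ha
  obtain ⟨b, hb, hab⟩ := Ideal.mem_span_singleton_mul.mp hmem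
  refine ⟨b, hb, ?_⟩
  have hab' := congrArg (algebraMap R (FractionRing R)) hab
  simp only [map_mul] at hab'
  simp only [Algebra.linearMap_apply]
  linear_combination y * hab' - algebraMap R (FractionRing R) b * hy

lemma exists_nonZeroDivisor_mem_condC
    (hfin : (Rbar R).FG) : ∃ c ∈ R⁰, algebraMap R (FractionRing R) c ∈ condC R := by
  obtain ⟨s, hs⟩ := hfin
  obtain ⟨c, hc⟩ := IsLocalization.exist_integer_multiples_of_finset R⁰ s
  refine ⟨c, c.2, fun w hw => ?_⟩
  change algebraMap R (FractionRing R) c * w ∈ (1 : Submodule R (FractionRing R))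
  rw [← hs] at hw
  induction hw using Submodule.span_induction with
  | mem w hw =>
    obtain ⟨r, hr⟩ := hc w hw
    exact Submodule.mem_one.mpr ⟨r, by rw [hr, Algebra.smul_def]⟩
  | zero => simp
  | add a b _ _ ha hb => rw [mul_add]; exact add_mem ha hb
  | smul r a _ ha => rw [mul_smul_comm]; exact Submodule.smul_mem _ r ha

lemma one_mem_Rbar : (1 : FractionRing R) ∈ Rbar R := one_mem (integralClosure R (FractionRing R))

lemma mul_mem_Rbar {a b : FractionRing R} (ha : a ∈ Rbar R) (hb : b ∈ Rbar R) : a * b ∈ Rbar R :=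
  (integralClosure R (FractionRing R)).mul_mem ha hb

lemma condC_le_one : condC R ≤ 1 := fun c hc => by
  simpa using hc 1 one_mem_Rbar

lemma fg_of_le_one [IsNoetherianRing R] {N : Submodule R (FractionRing R)} (hN : N ≤ 1) :
    N.FG := by
  have : IsNoetherian R (1 : Submodule R (FractionRing R)) := by
    rw [Submodule.one_eq_range]
    infer_instance
  have := isNoetherian_of_le hN
  exact (Submodule.fg_top _).mp (IsNoetherian.noetherian _)

lemma one_div_condC_le_Rbar [IsNoetherianRing R] (hfin : (Rbar R).FG) :
    1 / condC R ≤ Rbar R := by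
  intro z hz
  obtain ⟨c, hc0, hc⟩ := exists_nonZeroDivisor_mem_condC hfin
  obtain ⟨v, hv⟩ := exists_inv_algebraMap hc0
  refine isIntegral_of_mul_mem_of_fg (fg_of_le_one condC_le_one) hc hv fun n hn w hw => ?_
  change z * n * w ∈ (1 : Submodule R (FractionRing R))
  rw [mul_assoc]
  refine hz _ fun w' hw' => ?_
  change n * w * w' ∈ (1 : Submodule R (FractionRing R))
  rw [mul_assoc]
  exact hn _ (mul_mem_Rbar hw hw')

lemma mem_intCl_of_mul_mem_Rbar {I : Ideal R} {x r : R} (hxI : x ∈ I)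
    {z : FractionRing R} (hz : z ∈ Rbar R)
    (hr : algebraMap R (FractionRing R) r = algebraMap R (FractionRing R) x * z) :
    algebraMap R (FractionRing R) r ∈ intCl R I := by
  refine Submodule.subset_span ⟨r, ?_, rfl⟩
  obtain ⟨p, hp, hpz⟩ := hz
  refine ⟨p.scaleRoots x, (Polynomial.monic_scaleRoots_iff x).mpr hp, fun i _ => ?_, ?_⟩
  · rw [Polynomial.coeff_scaleRoots, Polynomial.natDegree_scaleRoots]
    exact Ideal.mul_mem_left _ _ (Ideal.pow_mem_pow hxI _)
  · apply IsFractionRing.injective R (FractionRing R)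
    have h := Polynomial.scaleRoots_aeval_eq_zero (r := x) hpz
    rw [← hr, Polynomial.aeval_algebraMap_apply] at h
    simpa using h

lemma intCl_le_one (I : Ideal R) : intCl R I ≤ 1 := by
  refine Submodule.span_le.mpr ?_
  rintro - ⟨r, -, rfl⟩
  exact Submodule.mem_one.mpr ⟨r, rfl⟩

/-- An element `x` of `J` with `x⁻¹ J ⊆ R̄` generates a reduction of `J`. -/
lemma isIdealReduction_of_mul_mem_Rbar [IsNoetherianRing R] (hfin : (Rbar R).FG) {J : Ideal R}
    {x : R} (hxJ : x ∈ J) {y : FractionRing R}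
    (hy : algebraMap R (FractionRing R) x * y = 1)
    (hJ : ∀ j ∈ J, algebraMap R (FractionRing R) j * y ∈ Rbar R) :
    IsIdealReduction (Ideal.span {x}) J := by
  have hle : Ideal.span {x} ≤ J := (Ideal.span_singleton_le_iff_mem J).mpr hxJ
  have hpow (n : ℕ) : ∀ a ∈ J ^ n, algebraMap R (FractionRing R) a * y ^ n ∈ Rbar R := by
    induction n with
    | zero =>
      intro a _
      rw [pow_zero, mul_one]
      exact algebraMap_mem (integralClosure R (FractionRing R)) a
    | succ n ih =>
      intro a ha
      rw [pow_succ] at ha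
      induction ha using Submodule.mul_induction_on' with
      | mem_mul_mem a ha b hb =>
        have h := mul_mem_Rbar (ih a ha) (hJ b hb)
        have e : algebraMap R (FractionRing R) (a * b) * y ^ (n + 1) =
            algebraMap R (FractionRing R) a * y ^ n * (algebraMap R (FractionRing R) b * y) := by
          rw [map_mul]; ring
        rw [e]
        exact h
      | add a _ b _ ha hb =>
        rw [map_add, add_mul]
        exact add_mem ha hb
  have hnoeth : IsNoetherian R (Rbar R) := isNoetherian_of_fg_of_noetherian _ hfin
  let f : ℕ →o Submodule R (Rbar R) :=
    { toFun := fun n => ((idl R (J ^ n)).map (LinearMap.mulRight R (y ^ n))).comap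
        (Rbar R).subtype
      monotone' := monotone_nat_of_le_succ fun n => Submodule.comap_mono <| by
        rintro - ⟨-, ⟨a, ha, rfl⟩, rfl⟩
        refine ⟨algebraMap R _ (a * x), mem_idl_algebraMap.mpr ?_, ?_⟩
        · rw [pow_succ]
          exact Ideal.mul_mem_mul ha hxJ
        · simp only [LinearMap.mulRight_apply, Algebra.linearMap_apply, map_mul]
          linear_combination algebraMap R (FractionRing R) a * y ^ n * hy }
  obtain ⟨n, hn⟩ := monotone_stabilizes_iff_noetherian.mpr hnoeth f
  refine ⟨hle, n, le_antisymm ?_ fun a ha => ?_⟩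
  · rw [pow_succ']
    exact Ideal.mul_mono_left hle
  · have hmem : (⟨_, hpow (n + 1) a ha⟩ : Rbar R) ∈ f (n + 1) :=
      ⟨algebraMap R _ a, mem_idl_algebraMap.mpr ha, rfl⟩
    rw [← hn (n + 1) n.le_succ] at hmem
    obtain ⟨-, ⟨b, hb, rfl⟩, hab⟩ := hmem
    refine Ideal.mem_span_singleton_mul.mpr ⟨b, hb, ?_⟩
    apply IsFractionRing.injective R (FractionRing R)
    have hyn : algebraMap R (FractionRing R) x ^ (n + 1) * y ^ (n + 1) = 1 := by
      rw [← mul_pow, hy, one_pow]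
    have hyn' : algebraMap R (FractionRing R) x ^ n * y ^ n = 1 := by
      rw [← mul_pow, hy, one_pow]
    simp only [LinearMap.mulRight_apply, Algebra.linearMap_apply, Submodule.subtype_apply] at hab
    rw [map_mul]
    linear_combination algebraMap R (FractionRing R) x ^ (n + 1) * hab
      + algebraMap R (FractionRing R) a * hyn
      - algebraMap R (FractionRing R) b * algebraMap R (FractionRing R) x * hyn'

/-- In a noetherian local ring, a principal reduction generated by a regular element is minimal. -/
lemma IsIdealReduction.isMinimalReduction [IsNoetherianRing R] [IsLocalRing R] {J : Ideal R}
    {x : R} (hx0 : x ∈ R⁰) (hx : IsIdealReduction (Ideal.span {x}) J) :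
    IsMinimalReduction (Ideal.span {x}) J := by
  refine ⟨hx, fun K ⟨_, n, hn⟩ hKx => le_antisymm hKx ?_⟩
  have hxJ : x ∈ J := hx.1 (Ideal.mem_span_singleton_self x)
  rw [Ideal.span_singleton_le_iff_mem]
  by_contra hxK
  have hKm : K ≤ Ideal.span {x} * IsLocalRing.maximalIdeal R := by
    intro k hk
    obtain ⟨l, rfl⟩ := Ideal.mem_span_singleton'.mp (hKx hk)
    refine Ideal.mem_span_singleton_mul.mpr ⟨l, fun hl => hxK ?_, mul_comm _ _⟩
    exact (Ideal.unit_mul_mem_iff_mem K hl).mp hk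
  have hJm : J ^ n ≤ IsLocalRing.maximalIdeal R • J ^ n := by
    intro a ha
    have h : x * a ∈ Ideal.span {x} * (IsLocalRing.maximalIdeal R * J ^ n) := by
      rw [← mul_assoc]
      refine Ideal.mul_mono_left hKm ?_
      rw [hn, pow_succ']
      exact Ideal.mul_mem_mul hxJ ha
    obtain ⟨b, hb, hab⟩ := Ideal.mem_span_singleton_mul.mp h
    rwa [← (mul_cancel_left_mem_nonZeroDivisors hx0).mp hab]
  have hbot := Submodule.eq_bot_of_le_smul_of_le_jacobson_bot _ _
    ((isNoetherianRing_iff_ideal_fg R).mp inferInstance _) hJm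
    (IsLocalRing.maximalIdeal_le_jacobson _)
  have hxn : x ^ n = 0 := by simpa [hbot] using Ideal.pow_mem_pow hxJ n
  exact zero_notMem_nonZeroDivisors (hxn ▸ pow_mem hx0 n)

end

theorem statement_7
    (R : Type*) [CommRing R] [IsNoetherianRing R] [IsLocalRing R] [IsReduced R]
    (hdim : ringKrullDim R = 1)
    (hCM : ∃ x ∈ IsLocalRing.maximalIdeal R, x ∈ R⁰)
    [Infinite (IsLocalRing.ResidueField R)]
    (hfin : (Subalgebra.toSubmodule (integralClosure R (FractionRing R))).FG)
    (I : Ideal R) (hIreg : ∃ r ∈ I, r ∈ R⁰)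
    (x : R) (hx : IsMinimalReduction (Ideal.span {x}) I) :
    ((1 : Submodule R (FractionRing R)) / (1 / idl R I) ≤ intCl R I) ∧
    IsMinimalReduction (Ideal.span {x})
      (Submodule.comap (Algebra.linearMap R (FractionRing R))
        ((1 : Submodule R (FractionRing R)) / (1 / idl R I))) ∧
    ((condC R ≤ idl R I ∧ ¬∃ r : R, I = Ideal.span {r}) →
      smulQ (algebraMap R (FractionRing R) x) (intCl R I / intCl R I) ≤
        (1 : Submodule R (FractionRing R)) / (1 / idl R I)) := by
  have hx0 : x ∈ R⁰ := mem_nonZeroDivisors_of_isIdealReduction hIreg hx.1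
  have hxI : x ∈ I := hx.1.1 (Ideal.mem_span_singleton_self x)
  obtain ⟨y, hy⟩ := exists_inv_algebraMap hx0
  have hone : (1 : FractionRing R) ∈ (1 : Submodule R (FractionRing R)) / idl R I := by
    rintro - ⟨i, -, rfl⟩
    exact Submodule.mem_one.mpr ⟨i, by simp⟩
  have hdiv_le : (1 : Submodule R (FractionRing R)) / (1 / idl R I) ≤ 1 := fun d hd => by
    simpa using hd 1 hone
  have hdiv_mul (d : FractionRing R)
      (hd : d ∈ (1 : Submodule R (FractionRing R)) / (1 / idl R I)) : d * y ∈ Rbar R := by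
    refine one_div_condC_le_Rbar hfin fun c hc => ?_
    change d * y * c ∈ (1 : Submodule R (FractionRing R))
    rw [mul_assoc]
    refine hd _ ?_
    rintro - ⟨i, hi, rfl⟩
    have h := hc _ (mul_mem_Rbar_of_isIdealReduction hx0 hx.1 hy hi)
    convert h using 1
    simp only [Algebra.linearMap_apply]
    ring
  refine ⟨fun d hd => ?_, ?_, ?_⟩
  · obtain ⟨r, rfl⟩ := Submodule.mem_one.mp (hdiv_le hd)
    refine mem_intCl_of_mul_mem_Rbar hxI (hdiv_mul _ hd) ?_
    linear_combination -algebraMap R (FractionRing R) r * hy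
  · refine IsIdealReduction.isMinimalReduction hx0
      (isIdealReduction_of_mul_mem_Rbar hfin ?_ hy fun j hj => hdiv_mul _ hj)
    intro w hw
    change algebraMap R (FractionRing R) x * w ∈ (1 : Submodule R (FractionRing R))
    rw [mul_comm]
    exact hw _ (mem_idl_algebraMap.mpr hxI)
  · rintro ⟨hCI, -⟩
    intro t ht
    obtain ⟨u, hu, rfl⟩ := Submodule.mem_span_singleton_mul.mp ht
    intro w hw
    have hwbar : w ∈ Rbar R := one_div_condC_le_Rbar hfin fun c hc => hw c (hCI hc)
    obtain ⟨r, hr⟩ := Submodule.mem_one.mp (hw _ (mem_idl_algebraMap.mpr hxI))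
    have hmem := mem_intCl_of_mul_mem_Rbar hxI hwbar (hr.trans (mul_comm _ _))
    have h := intCl_le_one I (hu _ hmem)
    convert h using 1
    rw [hr]
    ring
end
end

section
/- If R is not a discrete valuation ring, then R:𝔪 = 𝔪:𝔪 and R ≠ 𝔪:𝔪. -/
open scoped nonZeroDivisors

noncomputable section

open IsLocalRing in
/-- A nonzero element of a noetherian local ring with principal maximal ideal `(a)` is a unit
times a power of `a`. -/
theorem exists_eq_pow_mul_isUnit_of_maximalIdeal_eq_span {R : Type*} [CommRing R]
    [IsNoetherianRing R] [IsLocalRing R] {a : R} (ha : maximalIdeal R = Ideal.span {a})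
    {r : R} (hr : r ≠ 0) : ∃ (n : ℕ) (u : R), IsUnit u ∧ r = a ^ n * u := by
  have hex : ∃ n : ℕ, r ∉ maximalIdeal R ^ n := by
    by_contra! h
    apply hr
    have hmem : r ∈ ⨅ i : ℕ, maximalIdeal R ^ i := Ideal.mem_iInf.mpr h
    rwa [Ideal.iInf_pow_eq_bot_of_isLocalRing _ (maximalIdeal.isMaximal R).ne_top] at hmem
  classical
  obtain ⟨n, hn⟩ : ∃ n, Nat.find hex = n + 1 := by
    refine Nat.exists_eq_succ_of_ne_zero fun h0 => ?_
    have := Nat.find_spec hex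
    simp [h0] at this
  have hlast : r ∉ maximalIdeal R ^ (n + 1) := hn ▸ Nat.find_spec hex
  have hmem : r ∈ maximalIdeal R ^ n := not_not.mp (Nat.find_min hex (m := n) (by omega))
  rw [ha, Ideal.span_singleton_pow, Ideal.mem_span_singleton] at hmem hlast
  obtain ⟨u, rfl⟩ := hmem
  refine ⟨n, u, ?_, rfl⟩
  by_contra hu
  have hum : u ∈ maximalIdeal R := (mem_maximalIdeal u).mpr hu
  rw [ha, Ideal.mem_span_singleton] at hum
  exact hlast (pow_succ a n ▸ mul_dvd_mul_left _ hum)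

open IsLocalRing in
/-- A noetherian local ring whose maximal ideal is generated by a regular element is a
principal ideal domain. -/
theorem isDomain_and_isPrincipalIdealRing_of_maximalIdeal_eq_span {R : Type*} [CommRing R]
    [IsNoetherianRing R] [IsLocalRing R] {a : R} (ha : maximalIdeal R = Ideal.span {a})
    (hreg : a ∈ R⁰) : IsDomain R ∧ IsPrincipalIdealRing R := by
  have : NoZeroDivisors R := by
    refine ⟨fun {x y} hxy => ?_⟩
    by_contra! h
    obtain ⟨n, u, hu, rfl⟩ := exists_eq_pow_mul_isUnit_of_maximalIdeal_eq_span ha h.1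
    obtain ⟨m, v, hv, rfl⟩ := exists_eq_pow_mul_isUnit_of_maximalIdeal_eq_span ha h.2
    exact nonZeroDivisors.ne_zero
      (mul_mem (mul_mem (pow_mem hreg n) hu.mem_nonZeroDivisors)
        (mul_mem (pow_mem hreg m) hv.mem_nonZeroDivisors)) hxy
  have hdom : IsDomain R := NoZeroDivisors.to_isDomain R
  exact ⟨hdom, ((tfae_of_isNoetherianRing_of_isLocalRing_of_isDomain R).out 4 0 :
    (maximalIdeal R).IsPrincipal ↔ IsPrincipalIdealRing R).mp ⟨a, ha⟩⟩

open IsLocalRing in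
/-- In a noetherian local ring of dimension at most one, a regular element `x` of the maximal
ideal `𝔪` has a multiplier `y ∉ (x)` with `y 𝔪 ⊆ (x)`. -/
theorem exists_notMem_span_forall_mul_mem_span {R : Type*} [CommRing R] [IsNoetherianRing R]
    [IsLocalRing R] [Ring.KrullDimLE 1 R] {x : R} (hx : x ∈ maximalIdeal R) (hreg : x ∈ R⁰) :
    ∃ y ∉ Ideal.span {x}, ∀ b ∈ maximalIdeal R, y * b ∈ Ideal.span {x} := by
  have hrad : maximalIdeal R ≤ (Ideal.span {x}).radical := by
    rw [Ideal.radical_eq_sInf]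
    refine le_sInf fun p ⟨hxp, hp⟩ => ?_
    rcases Ring.krullDimLE_one_iff.mp inferInstance p hp with hmin | hmax
    · exact (Set.disjoint_left.mp (Ideal.disjoint_nonZeroDivisors_of_mem_minimalPrimes hmin)
        (hxp (Ideal.mem_span_singleton_self x)) hreg).elim
    · exact (eq_maximalIdeal hmax).ge
  have hex : ∃ n : ℕ, maximalIdeal R ^ n ≤ Ideal.span {x} :=
    Ideal.exists_pow_le_of_le_radical_of_fg hrad (IsNoetherian.noetherian _)
  classical
  obtain ⟨n, hn⟩ : ∃ n, Nat.find hex = n + 1 := by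
    refine Nat.exists_eq_succ_of_ne_zero fun h0 => ?_
    have htop := Nat.find_spec hex
    rw [h0, pow_zero, Ideal.one_eq_top, top_le_iff, Ideal.span_singleton_eq_top] at htop
    exact (mem_maximalIdeal x).mp hx htop
  have hle : maximalIdeal R ^ (n + 1) ≤ Ideal.span {x} := hn ▸ Nat.find_spec hex
  obtain ⟨y, hy, hyx⟩ := SetLike.not_le_iff_exists.mp (Nat.find_min hex (m := n) (by omega))
  exact ⟨y, hyx, fun b hb => hle (pow_succ (maximalIdeal R) n ▸ Ideal.mul_mem_mul hy hb)⟩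

theorem algebraMap_mem_idl {R : Type*} [CommRing R] {I : Ideal R} {r : R} (hr : r ∈ I) :
    algebraMap R (FractionRing R) r ∈ idl R I :=
  ⟨r, hr, rfl⟩

theorem idl_le_one {R : Type*} [CommRing R] (I : Ideal R) : idl R I ≤ 1 := by
  rintro _ ⟨r, -, rfl⟩
  exact Submodule.mem_one.mpr ⟨r, rfl⟩

open IsLocalRing in
/-- If `R : 𝔪` is not contained in `𝔪 : 𝔪`, then `𝔪` is generated by a regular element. -/
theorem exists_maximalIdeal_eq_span_of_not_one_div_le {R : Type*} [CommRing R] [IsLocalRing R]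
    (h : ¬ (1 : Submodule R (FractionRing R)) / idl R (maximalIdeal R) ≤
      idl R (maximalIdeal R) / idl R (maximalIdeal R)) :
    ∃ a ∈ R⁰, maximalIdeal R = Ideal.span {a} := by
  have hinj := IsFractionRing.injective R (FractionRing R)
  obtain ⟨z, hz, hzm⟩ := SetLike.not_le_iff_exists.mp h
  rw [Submodule.mem_div_iff_forall_mul_mem] at hz hzm
  push Not at hzm
  obtain ⟨_, ⟨a, ha, rfl⟩, hza⟩ := hzm
  obtain ⟨u, hu⟩ := Submodule.mem_one.mp (hz _ (algebraMap_mem_idl ha))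
  have hunit : IsUnit u := by
    by_contra hnu
    refine hza ?_
    rw [Algebra.linearMap_apply, ← hu]
    exact algebraMap_mem_idl ((mem_maximalIdeal u).mpr hnu)
  have hmul {b c : R} (hc : algebraMap R (FractionRing R) c =
      z * algebraMap R (FractionRing R) b) : u * b = a * c := by
    apply hinj
    rw [map_mul, map_mul, hu, hc]
    ring
  refine ⟨a, mem_nonZeroDivisors_iff_right.mpr fun b hb => ?_, le_antisymm (fun b hb => ?_) ?_⟩
  · have hub : algebraMap R (FractionRing R) (u * b) = 0 := by
      rw [map_mul, hu, mul_assoc, ← map_mul, mul_comm a b, hb, map_zero, mul_zero]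
    exact hunit.mul_right_eq_zero.mp (hinj (hub.trans (map_zero _).symm))
  · obtain ⟨c, hc⟩ := Submodule.mem_one.mp (hz _ (algebraMap_mem_idl hb))
    rw [Ideal.mem_span_singleton, ← hunit.dvd_mul_left, hmul hc]
    exact dvd_mul_right a c
  · rwa [Ideal.span_singleton_le_iff_mem]

open IsLocalRing in
/-- In a noetherian local ring of dimension at most one whose maximal ideal `𝔪` contains a
regular element, `R : 𝔪` is strictly larger than `R`. -/
theorem not_one_div_idl_maximalIdeal_le_one {R : Type*} [CommRing R] [IsNoetherianRing R]
    [IsLocalRing R] [Ring.KrullDimLE 1 R] (hCM : ∃ x ∈ maximalIdeal R, x ∈ R⁰) :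
    ¬ (1 : Submodule R (FractionRing R)) / idl R (maximalIdeal R) ≤ 1 := by
  intro hle
  have hinj := IsFractionRing.injective R (FractionRing R)
  obtain ⟨x, hx, hreg⟩ := hCM
  obtain ⟨y, hyx, hy⟩ := exists_notMem_span_forall_mul_mem_span hx hreg
  let z : FractionRing R := IsLocalization.mk' _ y ⟨x, hreg⟩
  have hzx : z * algebraMap R _ x = algebraMap R _ y := IsLocalization.mk'_spec _ y ⟨x, hreg⟩
  have hz : z ∈ (1 : Submodule R (FractionRing R)) / idl R (maximalIdeal R) := by
    rw [Submodule.mem_div_iff_forall_mul_mem]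
    rintro _ ⟨b, hb, rfl⟩
    obtain ⟨c, hc⟩ := Ideal.mem_span_singleton.mp (hy b hb)
    refine Submodule.mem_one.mpr ⟨c, ?_⟩
    apply (IsLocalization.map_units (FractionRing R) (⟨x, hreg⟩ : R⁰)).mul_left_cancel
    rw [Algebra.linearMap_apply, ← map_mul, ← hc, map_mul, ← hzx]
    ring
  obtain ⟨r, hr⟩ := Submodule.mem_one.mp (hle hz)
  refine hyx (Ideal.mem_span_singleton'.mpr ⟨r, hinj ?_⟩)
  rw [map_mul, hr, hzx]

theorem statement_13
    (R : Type*) [CommRing R] [IsNoetherianRing R] [IsLocalRing R] [IsReduced R]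
    (hdim : ringKrullDim R = 1)
    (hCM : ∃ x ∈ IsLocalRing.maximalIdeal R, x ∈ R⁰)
    [Infinite (IsLocalRing.ResidueField R)]
    (hfin : (Subalgebra.toSubmodule (integralClosure R (FractionRing R))).FG)
    (hnotDVR : ¬(IsDomain R ∧ IsPrincipalIdealRing R)) :
    (1 : Submodule R (FractionRing R)) / idl R (IsLocalRing.maximalIdeal R) =
      idl R (IsLocalRing.maximalIdeal R) / idl R (IsLocalRing.maximalIdeal R) ∧
    (1 : Submodule R (FractionRing R)) ≠
      idl R (IsLocalRing.maximalIdeal R) / idl R (IsLocalRing.maximalIdeal R) := by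
  have : Ring.KrullDimLE 1 R := Ring.krullDimLE_iff.mpr (by simp [hdim])
  have heq : (1 : Submodule R (FractionRing R)) / idl R (IsLocalRing.maximalIdeal R) =
      idl R (IsLocalRing.maximalIdeal R) / idl R (IsLocalRing.maximalIdeal R) := by
    refine le_antisymm ?_ fun z hz b hb => idl_le_one _ (hz b hb)
    by_contra h
    obtain ⟨a, hreg, ha⟩ := exists_maximalIdeal_eq_span_of_not_one_div_le h
    exact hnotDVR (isDomain_and_isPrincipalIdealRing_of_maximalIdeal_eq_span ha hreg)
  exact ⟨heq, fun h => not_one_div_idl_maximalIdeal_le_one hCM (heq.trans h.symm).le⟩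
end
end
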